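/- Let n ≥ 1 and let H : ℝ → ℂ → Matrix (Fin n) (Fin n) ℂ, (ρ, s) ↦ H_ρ(s), be entrywise jointly continuously differentiable near (ρ₀, λ₀), with H_ρ entrywise analytic in s near λ₀ for each ρ near ρ₀. Let d(s) = det H_{ρ₀}(s), suppose d(λ₀) = 0 and d'(λ₀) ≠ 0, and let λ : ℝ → ℂ be differentiable at ρ₀ with λ(ρ₀) = λ₀ and det H_ρ(λ(ρ)) = 0 for ρ near ρ₀. Define the residue matrix R = adjugate(H_{ρ₀}(λ₀)) / d'(λ₀), which equals Res_{λ₀} (H_{ρ₀})⁻¹. Then λ'(ρ₀) = ⟨ −R*, (∂H_ρ(λ₀)/∂ρ)|_{ρ=ρ₀} ⟩, where ⟨·,·⟩ is the Frobenius inner product and R* is the conjugate transpose of R. -/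

import Mathlib

open Filter Topology Matrix

/-- Frobenius inner product of complex matrices: `⟨V, W⟩ = Σ_{h,l} conj(V h l) * W h l`. -/
noncomputable def frobInner {n m : ℕ} (V W : Matrix (Fin n) (Fin m) ℂ) : ℂ :=
  ∑ h, ∑ l, (starRingEnd ℂ) (V h l) * W h l

theorem jacobi_aux {n : ℕ} (A : ℝ → Matrix (Fin n) (Fin n) ℂ) (A' : Matrix (Fin n) (Fin n) ℂ)
    (t : ℝ) (h : ∀ i j, HasDerivAt (fun x => A x i j) (A' i j) t) :
    HasDerivAt (fun x => (A x).det) (∑ i, ∑ j, (A t).adjugate i j * A' j i) t := by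
  have h1 : HasDerivAt (fun x => (A x).det)
      (∑ σ : Equiv.Perm (Fin n), ((Equiv.Perm.sign σ : ℤ) : ℂ) *
        ∑ i, (∏ j ∈ Finset.univ.erase i, A t (σ j) j) • A' (σ i) i) t := by
    simp only [Matrix.det_apply']
    exact HasDerivAt.fun_sum fun σ _ =>
      (HasDerivAt.fun_finsetProd fun i _ => h (σ i) i).const_mul _
  convert h1 using 1
  have h2 : ∀ i, ∑ j, (A t).adjugate i j * A' j i
      = ((A t).updateCol i (fun j => A' j i)).det := by
    intro i
    rw [← Matrix.cramer_apply, Matrix.cramer_eq_adjugate_mulVec]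
    rfl
  simp only [h2, Matrix.det_apply', Finset.mul_sum]
  rw [Finset.sum_comm]
  refine Finset.sum_congr rfl fun σ _ => Finset.sum_congr rfl fun i _ => ?_
  rw [← Finset.prod_erase_mul _ _ (Finset.mem_univ i)]
  simp only [Matrix.updateCol_self, smul_eq_mul]
  congr 2
  refine Finset.prod_congr rfl fun j hj => ?_
  rw [Matrix.updateCol_ne (Finset.ne_of_mem_erase hj)]

/-- The paper's Lemma 1, matrix case, in residue/Frobenius form: with
`R = adjugate (H_{ρ₀}(l₀)) / d'(l₀)` the residue matrix of `G = H⁻¹` at its simple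
pole `l₀` (i.e. `R = lim_{s→l₀} (s - l₀)(H_{ρ₀} s)⁻¹` entrywise), the root
sensitivity is `λ'(ρ₀) = ⟨ -R*, (∂H/∂ρ)(ρ₀, l₀) ⟩` with `⟨·,·⟩` the Frobenius
inner product and `R*` the conjugate transpose of `R`. -/
theorem matrix_root_sensitivity_frobenius
    (n : ℕ) (hn : 1 ≤ n)
    (H : ℝ → ℂ → Matrix (Fin n) (Fin n) ℂ) (ρ₀ : ℝ) (l₀ : ℂ)
    (hC1 : ∀ i j, ContDiffAt ℝ 1 (fun q : ℝ × ℂ => H q.1 q.2 i j) (ρ₀, l₀))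
    (hAnal : ∀ᶠ ρ in 𝓝 ρ₀, ∀ i j, AnalyticAt ℂ (fun s => H ρ s i j) l₀)
    (d : ℂ → ℂ) (hd : ∀ s, d s = (H ρ₀ s).det)
    (hd₀ : d l₀ = 0)
    (d' : ℂ) (hd' : HasDerivAt d d' l₀) (hdne : d' ≠ 0)
    (lam : ℝ → ℂ) (lam' : ℂ)
    (hlam : HasDerivAt lam lam' ρ₀)
    (hlam₀ : lam ρ₀ = l₀)
    (hroot : ∀ᶠ ρ in 𝓝 ρ₀, (H ρ (lam ρ)).det = 0)
    (Hρ : Matrix (Fin n) (Fin n) ℂ)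
    (hHρ : ∀ i j, HasDerivAt (fun ρ => H ρ l₀ i j) (Hρ i j) ρ₀)
    (R : Matrix (Fin n) (Fin n) ℂ)
    (hR : R = d'⁻¹ • (H ρ₀ l₀).adjugate) :
    (∀ i j, Tendsto (fun s => (s - l₀) * (H ρ₀ s)⁻¹ i j) (𝓝[≠] l₀) (𝓝 (R i j))) ∧
      lam' = frobInner (-Rᴴ) Hρ := by
  constructor
  · intro i j
    have hc : ContinuousAt (fun s => H ρ₀ s) l₀ := by
      refine continuousAt_pi.2 fun i => continuousAt_pi.2 fun j => ?_
      exact (hAnal.self_of_nhds i j).continuousAt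
    have hadj : Tendsto (fun s => (H ρ₀ s).adjugate i j) (𝓝[≠] l₀)
        (𝓝 ((H ρ₀ l₀).adjugate i j)) := by
      have hcc : Continuous fun M : Matrix (Fin n) (Fin n) ℂ => M.adjugate i j :=
        (continuous_id.matrix_adjugate).matrix_elem i j
      have := hcc.continuousAt.comp (f := fun s => H ρ₀ s) hc
      exact this.tendsto.mono_left nhdsWithin_le_nhds
    have hs := (hasDerivAt_iff_tendsto_slope.1 hd').inv₀ hdne
    have := hs.mul hadj
    subst hR
    refine this.congr fun s => ?_
    rw [slope_def_field, hd₀, sub_zero, Matrix.inv_def, hd s, Ring.inverse_eq_inv']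
    simp only [Matrix.smul_apply, smul_eq_mul]
    rw [inv_div]
    ring
  · have hF : DifferentiableAt ℝ (fun q : ℝ × ℂ => (H q.1 q.2).det) (ρ₀, l₀) := by
      simp only [Matrix.det_apply']
      refine DifferentiableAt.fun_sum fun σ _ => DifferentiableAt.const_mul ?_ _
      have hi : ∀ i ∈ (Finset.univ : Finset (Fin n)), HasFDerivAt
          (fun q : ℝ × ℂ => H q.1 q.2 (σ i) i) _ (ρ₀, l₀) :=
        fun i _ => ((hC1 (σ i) i).differentiableAt one_ne_zero).hasFDerivAt
      exact (HasFDerivAt.finset_prod hi).differentiableAt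
    obtain ⟨F', hF'⟩ := hF
    have e1 : F' (1, lam') = 0 := by
      have h1 : HasDerivAt (fun ρ => (ρ, lam ρ)) ((1 : ℝ), lam') ρ₀ :=
        (hasDerivAt_id ρ₀).prodMk hlam
      have h2 := HasFDerivAt.comp_hasDerivAt_of_eq ρ₀ hF' h1 (by simp [hlam₀])
      exact h2.unique ((hasDerivAt_const ρ₀ (0 : ℂ)).congr_of_eventuallyEq hroot)
    have e2 : F' (1, 0) = ∑ i, ∑ j, (H ρ₀ l₀).adjugate i j * Hρ j i := by
      have h1 : HasDerivAt (fun ρ : ℝ => (ρ, l₀)) ((1 : ℝ), (0 : ℂ)) ρ₀ :=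
        (hasDerivAt_id ρ₀).prodMk (hasDerivAt_const _ _)
      have h2 := HasFDerivAt.comp_hasDerivAt_of_eq ρ₀ hF' h1 rfl
      exact h2.unique (jacobi_aux (fun ρ => H ρ l₀) Hρ ρ₀ hHρ)
    have e3 : F' (0, lam') = lam' * d' := by
      have h1 : HasFDerivAt (fun s : ℂ => (ρ₀, s)) (ContinuousLinearMap.inr ℝ ℝ ℂ) l₀ :=
        hasFDerivAt_prodMk_right ρ₀ l₀
      have h2 := HasFDerivAt.comp l₀ hF' h1
      have h3 := hd'.hasFDerivAt.restrictScalars ℝ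
      have h4 : d = (fun q : ℝ × ℂ => (H q.1 q.2).det) ∘ (fun s : ℂ => (ρ₀, s)) := funext hd
      rw [h4] at h3
      have := congrArg (fun L : ℂ →L[ℝ] ℂ => L lam') (h2.unique h3)
      simpa using this
    have e4 : F' (1, lam') = F' (1, 0) + F' (0, lam') := by
      rw [← map_add]; simp
    have e5 : frobInner (-Rᴴ) Hρ
        = - (d'⁻¹ * ∑ i, ∑ j, (H ρ₀ l₀).adjugate i j * Hρ j i) := by
      rw [Finset.sum_comm, hR]
      simp only [frobInner, Matrix.neg_apply, Matrix.conjTranspose_apply, Matrix.smul_apply,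
        smul_eq_mul, map_neg, neg_mul, Finset.sum_neg_distrib, Finset.mul_sum]
      simp [mul_assoc]
    rw [e5, ← e2]
    have e6 : F' (1, 0) = - (lam' * d') := by
      rw [← e3]; linear_combination e1 - e4
    rw [e6]
    field_simp
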